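/- arXiv:1211.5865 — 2 statements merged into one kernel-verified Lean document; each statement's English description precedes it below -/
import Mathlib

section
/- Define the bilinear map φ : S(𝔤) × S(𝔤) → S(𝔤) by φ(a,b) := ½ Σ c^s_{ij} c^t_{kl} X_s X_t (∂^i∂^k a)(∂^j∂^l b) + ⅓ Σ c^t_{ks} c^s_{ji} X_t ((∂^k∂^j a)(∂^i b) + (∂^i a)(∂^k∂^j b)), where all repeated indices are summed. Then for all a, b, c ∈ S(𝔤), one has {a,{b,c}} − {{a,b},c} + a·φ(b,c) − φ(ab,c) + φ(a,bc) − φ(a,b)·c = 0. -/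
open TensorProduct MvPolynomial

noncomputable section

/-- The bilinear map `(a, b) ↦ u * D₁ a * D₂ b` on polynomials. -/
def bil {n : ℕ} (u : MvPolynomial (Fin n) ℂ)
    (D₁ D₂ : MvPolynomial (Fin n) ℂ →ₗ[ℂ] MvPolynomial (Fin n) ℂ) :
    MvPolynomial (Fin n) ℂ →ₗ[ℂ] MvPolynomial (Fin n) ℂ →ₗ[ℂ] MvPolynomial (Fin n) ℂ :=
  (((LinearMap.mul ℂ (MvPolynomial (Fin n) ℂ)).comp
      ((LinearMap.mulLeft ℂ u).comp D₁)).compl₂ D₂)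

/-- The Poisson bracket `{a,b} = Σ c^k_{ij} X_k (∂^i a)(∂^j b)` on `S(𝔤)`. -/
def Pb {n : ℕ} (c : Fin n → Fin n → Fin n → ℂ) :
    MvPolynomial (Fin n) ℂ →ₗ[ℂ] MvPolynomial (Fin n) ℂ →ₗ[ℂ] MvPolynomial (Fin n) ℂ :=
  ∑ i, ∑ j, ∑ k, c k i j •
    bil (X k) (pderiv i).toLinearMap (pderiv j).toLinearMap

/-- The bilinear map
`φ(a,b) = ½ Σ c^s_{ij} c^t_{kl} X_s X_t (∂^i∂^k a)(∂^j∂^l b)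
  + ⅓ Σ c^t_{ks} c^s_{ji} X_t ((∂^k∂^j a)(∂^i b) + (∂^i a)(∂^k∂^j b))`. -/
def phiL {n : ℕ} (c : Fin n → Fin n → Fin n → ℂ) :
    MvPolynomial (Fin n) ℂ →ₗ[ℂ] MvPolynomial (Fin n) ℂ →ₗ[ℂ] MvPolynomial (Fin n) ℂ :=
  (2 : ℂ)⁻¹ • (∑ i, ∑ j, ∑ k, ∑ l, ∑ s, ∑ t, (c s i j * c t k l) •
      bil (X s * X t) ((pderiv i).toLinearMap ∘ₗ (pderiv k).toLinearMap)
        ((pderiv j).toLinearMap ∘ₗ (pderiv l).toLinearMap))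
  + (3 : ℂ)⁻¹ • (∑ i, ∑ j, ∑ k, ∑ s, ∑ t, (c t k s * c s j i) •
      (bil (X t) ((pderiv k).toLinearMap ∘ₗ (pderiv j).toLinearMap) (pderiv i).toLinearMap
        + bil (X t) (pderiv i).toLinearMap ((pderiv k).toLinearMap ∘ₗ (pderiv j).toLinearMap)))

/-- The linear Poisson bivector `P^{ij} = {X_i, X_j} = Σ c^k_{ij} X_k`. -/
def bivector {n : ℕ} (c : Fin n → Fin n → Fin n → ℂ) (i j : Fin n) : MvPolynomial (Fin n) ℂ :=
  ∑ k, C (c k i j) * X k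

/-- The nested bracket `[X_k, [X_j, X_i]]`, as a linear polynomial. -/
def nested {n : ℕ} (c : Fin n → Fin n → Fin n → ℂ) (k j i : Fin n) : MvPolynomial (Fin n) ℂ :=
  ∑ s, C (c s j i) * bivector c k s

lemma bil_apply {n : ℕ} (u : MvPolynomial (Fin n) ℂ)
    (D₁ D₂ : MvPolynomial (Fin n) ℂ →ₗ[ℂ] MvPolynomial (Fin n) ℂ)
    (a b : MvPolynomial (Fin n) ℂ) : bil u D₁ D₂ a b = u * D₁ a * D₂ b := by
  simp [bil]

lemma Pb_apply {n : ℕ} (c : Fin n → Fin n → Fin n → ℂ) (a b : MvPolynomial (Fin n) ℂ) :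
    Pb c a b = ∑ i, ∑ j, bivector c i j * pderiv i a * pderiv j b := by
  simp [Pb, bil_apply, bivector, Finset.sum_mul, smul_eq_C_mul, mul_assoc]

lemma phiL_apply {n : ℕ} (c : Fin n → Fin n → Fin n → ℂ) (a b : MvPolynomial (Fin n) ℂ) :
    phiL c a b =
      C 2⁻¹ * (∑ i, ∑ j, ∑ k, ∑ l, bivector c i j * bivector c k l *
        pderiv i (pderiv k a) * pderiv j (pderiv l b))
      + C 3⁻¹ * (∑ i, ∑ j, ∑ k, nested c k j i *
        (pderiv k (pderiv j a) * pderiv i b + pderiv i a * pderiv k (pderiv j b))) := by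
  simp only [phiL, LinearMap.add_apply, LinearMap.smul_apply, LinearMap.sum_apply, bil_apply,
    smul_eq_C_mul, LinearMap.comp_apply, Derivation.coeFn_coe]
  refine congrArg₂ (· + ·) (congrArg (C 2⁻¹ * ·) ?_) (congrArg (C 3⁻¹ * ·) ?_)
  · refine Finset.sum_congr rfl fun i _ => Finset.sum_congr rfl fun j _ =>
      Finset.sum_congr rfl fun k _ => Finset.sum_congr rfl fun l _ => ?_
    rw [bivector, bivector, Finset.sum_mul_sum]
    simp only [Finset.sum_mul]
    refine Finset.sum_congr rfl fun s _ => Finset.sum_congr rfl fun t _ => ?_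
    rw [C_mul]
    ring
  · refine Finset.sum_congr rfl fun i _ => Finset.sum_congr rfl fun j _ =>
      Finset.sum_congr rfl fun k _ => ?_
    simp only [nested, bivector, Finset.mul_sum, Finset.sum_mul]
    refine Finset.sum_congr rfl fun s _ => Finset.sum_congr rfl fun t _ => ?_
    rw [C_mul]
    ring

lemma pderiv_bivector {n : ℕ} (c : Fin n → Fin n → Fin n → ℂ) (m i j : Fin n) :
    pderiv m (bivector c i j) = C (c m i j) := by
  simp [bivector, pderiv_X, Pi.single_apply]

lemma bivector_skew {n : ℕ} {c : Fin n → Fin n → Fin n → ℂ}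
    (hskew : ∀ k i j, c k i j = - c k j i) (i j : Fin n) :
    bivector c i j = - bivector c j i := by
  simp [bivector, hskew _ i j]

lemma nested_skew {n : ℕ} {c : Fin n → Fin n → Fin n → ℂ}
    (hskew : ∀ k i j, c k i j = - c k j i) (k i j : Fin n) :
    nested c k i j = - nested c k j i := by
  simp [nested, hskew _ i j]

lemma nested_jacobi {n : ℕ} {c : Fin n → Fin n → Fin n → ℂ}
    (hskew : ∀ k i j, c k i j = - c k j i)
    (hjac : ∀ i j l m, (∑ k, (c k i j * c m k l + c k j l * c m k i + c k l i * c m k j)) = 0)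
    (i j l : Fin n) :
    nested c l i j + nested c i j l + nested c j l i = 0 := by
  have h : ∀ m, ∑ k, (c k i j * c m l k + c k j l * c m i k + c k l i * c m j k) = 0 := by
    intro m
    rw [← neg_eq_zero, ← hjac i j l m, ← Finset.sum_neg_distrib]
    refine Finset.sum_congr rfl fun k _ => ?_
    rw [hskew m l k, hskew m i k, hskew m j k]
    ring
  simp only [nested, bivector, Finset.mul_sum, ← Finset.sum_add_distrib]
  rw [Finset.sum_comm]
  refine Finset.sum_eq_zero fun m _ => ?_
  have h' := congrArg (fun z => C z * X m : ℂ → MvPolynomial (Fin n) ℂ) (h m)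
  simp only [map_sum, Finset.sum_mul, map_zero, zero_mul, map_add, map_mul] at h'
  rw [← h']
  refine Finset.sum_congr rfl fun k _ => ?_
  ring

lemma sum_rotate {ι M : Type*} [Fintype ι] [AddCommMonoid M] (f : ι → ι → ι → M) :
    ∑ x, ∑ y, ∑ z, f x y z = ∑ x, ∑ y, ∑ z, f z x y :=
  Finset.sum_comm.trans (Finset.sum_congr rfl fun _ _ => Finset.sum_comm)

lemma Pb_Pb_right {n : ℕ} (c : Fin n → Fin n → Fin n → ℂ) (a b d : MvPolynomial (Fin n) ℂ) :
    Pb c a (Pb c b d) =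
      (∑ x, ∑ y, ∑ z, nested c x y z * (pderiv x a * pderiv y b * pderiv z d))
      + ∑ i, ∑ j, ∑ k, ∑ l, bivector c i j * bivector c k l *
          (pderiv i a * (pderiv j (pderiv k b) * pderiv l d
            + pderiv k b * pderiv j (pderiv l d))) := by
  have h : ∑ x, ∑ y, ∑ z, nested c x y z * (pderiv x a * pderiv y b * pderiv z d) =
      ∑ x, ∑ s, ∑ y, ∑ z,
        C (c s y z) * bivector c x s * (pderiv x a * pderiv y b * pderiv z d) := by
    simp only [nested, Finset.sum_mul]
    exact Finset.sum_congr rfl fun x _ => (sum_rotate fun s y z =>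
      C (c s y z) * bivector c x s * (pderiv x a * pderiv y b * pderiv z d)).symm
  rw [h, Pb_apply c b d, Pb_apply]
  simp only [map_sum, Derivation.leibniz, pderiv_bivector, smul_eq_mul,
    Finset.mul_sum, ← Finset.sum_add_distrib]
  refine Finset.sum_congr rfl fun i _ => Finset.sum_congr rfl fun j _ =>
    Finset.sum_congr rfl fun k _ => Finset.sum_congr rfl fun l _ => ?_
  ring

lemma Pb_skew {n : ℕ} {c : Fin n → Fin n → Fin n → ℂ}
    (hskew : ∀ k i j, c k i j = - c k j i) (a b : MvPolynomial (Fin n) ℂ) :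
    Pb c a b = - Pb c b a := by
  rw [Pb_apply, Pb_apply, Finset.sum_comm, ← Finset.sum_neg_distrib]
  refine Finset.sum_congr rfl fun i _ => ?_
  rw [← Finset.sum_neg_distrib]
  refine Finset.sum_congr rfl fun j _ => ?_
  rw [bivector_skew hskew j i]
  ring

lemma sum_swap_pairs {ι M : Type*} [Fintype ι] [AddCommMonoid M] (f : ι → ι → ι → ι → M) :
    ∑ i, ∑ j, ∑ k, ∑ l, f i j k l = ∑ i, ∑ j, ∑ k, ∑ l, f k l i j := by
  have h := Finset.sum_comm (s := Finset.univ) (t := Finset.univ)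
    (f := fun p q : ι × ι => f p.1 p.2 q.1 q.2)
  simpa only [Fintype.sum_prod_type] using h

/-- The Hochschild coboundary of `phiL`, expanded by the Leibniz rule. -/
lemma coboundary_phiL {n : ℕ} (c : Fin n → Fin n → Fin n → ℂ) (a b d : MvPolynomial (Fin n) ℂ) :
    a * phiL c b d - phiL c (a * b) d + phiL c a (b * d) - phiL c a b * d =
      C 2⁻¹ * (∑ i, ∑ j, ∑ k, ∑ l, bivector c i j * bivector c k l *
        (pderiv i (pderiv k a) * (pderiv j b * pderiv l d + pderiv l b * pderiv j d)
          - (pderiv i a * pderiv k b + pderiv k a * pderiv i b) * pderiv j (pderiv l d)))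
      + C 3⁻¹ * (∑ i, ∑ j, ∑ k, nested c k j i *
        (pderiv i a * (pderiv k b * pderiv j d + pderiv j b * pderiv k d)
          - (pderiv k a * pderiv j b + pderiv j a * pderiv k b) * pderiv i d)) := by
  have hS : a * (∑ i, ∑ j, ∑ k, ∑ l, bivector c i j * bivector c k l *
          pderiv i (pderiv k b) * pderiv j (pderiv l d))
        - (∑ i, ∑ j, ∑ k, ∑ l, bivector c i j * bivector c k l *
          pderiv i (pderiv k (a * b)) * pderiv j (pderiv l d))
        + (∑ i, ∑ j, ∑ k, ∑ l, bivector c i j * bivector c k l *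
          pderiv i (pderiv k a) * pderiv j (pderiv l (b * d)))
        - (∑ i, ∑ j, ∑ k, ∑ l, bivector c i j * bivector c k l *
          pderiv i (pderiv k a) * pderiv j (pderiv l b)) * d =
      ∑ i, ∑ j, ∑ k, ∑ l, bivector c i j * bivector c k l *
        (pderiv i (pderiv k a) * (pderiv j b * pderiv l d + pderiv l b * pderiv j d)
          - (pderiv i a * pderiv k b + pderiv k a * pderiv i b) * pderiv j (pderiv l d)) := by
    simp only [Finset.mul_sum, Finset.sum_mul, ← Finset.sum_add_distrib,
      ← Finset.sum_sub_distrib]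
    refine Finset.sum_congr rfl fun i _ => Finset.sum_congr rfl fun j _ =>
      Finset.sum_congr rfl fun k _ => Finset.sum_congr rfl fun l _ => ?_
    simp only [Derivation.leibniz, map_add, smul_eq_mul]
    ring
  have hT : a * (∑ i, ∑ j, ∑ k, nested c k j i *
          (pderiv k (pderiv j b) * pderiv i d + pderiv i b * pderiv k (pderiv j d)))
        - (∑ i, ∑ j, ∑ k, nested c k j i *
          (pderiv k (pderiv j (a * b)) * pderiv i d + pderiv i (a * b) * pderiv k (pderiv j d)))
        + (∑ i, ∑ j, ∑ k, nested c k j i *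
          (pderiv k (pderiv j a) * pderiv i (b * d) + pderiv i a * pderiv k (pderiv j (b * d))))
        - (∑ i, ∑ j, ∑ k, nested c k j i *
          (pderiv k (pderiv j a) * pderiv i b + pderiv i a * pderiv k (pderiv j b))) * d =
      ∑ i, ∑ j, ∑ k, nested c k j i *
        (pderiv i a * (pderiv k b * pderiv j d + pderiv j b * pderiv k d)
          - (pderiv k a * pderiv j b + pderiv j a * pderiv k b) * pderiv i d) := by
    simp only [Finset.mul_sum, Finset.sum_mul, ← Finset.sum_add_distrib,
      ← Finset.sum_sub_distrib]
    refine Finset.sum_congr rfl fun i _ => Finset.sum_congr rfl fun j _ =>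
      Finset.sum_congr rfl fun k _ => ?_
    simp only [Derivation.leibniz, map_add, smul_eq_mul]
    ring
  simp only [phiL_apply]
  linear_combination C 2⁻¹ * hS + C 3⁻¹ * hT

lemma pderiv_pderiv_comm {σ R : Type*} [CommRing R] (i j : σ) (p : MvPolynomial σ R) :
    pderiv i (pderiv j p) = pderiv j (pderiv i p) := by
  classical
  have h : ⁅(pderiv i : Derivation R (MvPolynomial σ R) (MvPolynomial σ R)),
      (pderiv j : Derivation R (MvPolynomial σ R) (MvPolynomial σ R))⁆ = 0 := by
    refine derivation_ext fun k => ?_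
    simp [Derivation.commutator_apply, pderiv_X, Pi.single_apply, apply_ite]
  simpa [Derivation.commutator_apply, sub_eq_zero] using congrArg (fun D => D p) h

lemma second_order_cancel {n : ℕ} {c : Fin n → Fin n → Fin n → ℂ}
    (hskew : ∀ k i j, c k i j = - c k j i) (a b d : MvPolynomial (Fin n) ℂ) :
    (∑ i, ∑ j, ∑ k, ∑ l, bivector c i j * bivector c k l *
          (pderiv i a * (pderiv j (pderiv k b) * pderiv l d
            + pderiv k b * pderiv j (pderiv l d))))
      + (∑ i, ∑ j, ∑ k, ∑ l, bivector c i j * bivector c k l *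
          (pderiv i d * (pderiv j (pderiv k a) * pderiv l b
            + pderiv k a * pderiv j (pderiv l b))))
      + C 2⁻¹ * (∑ i, ∑ j, ∑ k, ∑ l, bivector c i j * bivector c k l *
        (pderiv i (pderiv k a) * (pderiv j b * pderiv l d + pderiv l b * pderiv j d)
          - (pderiv i a * pderiv k b + pderiv k a * pderiv i b) * pderiv j (pderiv l d))) = 0 := by
  have half : (C 2⁻¹ : MvPolynomial (Fin n) ℂ) * 2 = 1 := by
    rw [show (2 : MvPolynomial (Fin n) ℂ) = C 2 from (map_ofNat C 2).symm, ← C_mul]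
    norm_num
  have hab : ∑ i, ∑ j, ∑ k, ∑ l, bivector c i j * bivector c k l *
        (pderiv k a * pderiv i b * pderiv j (pderiv l d)) =
      ∑ i, ∑ j, ∑ k, ∑ l, bivector c i j * bivector c k l *
        (pderiv i a * pderiv k b * pderiv j (pderiv l d)) := by
    rw [sum_swap_pairs]
    refine Finset.sum_congr rfl fun i _ => Finset.sum_congr rfl fun j _ =>
      Finset.sum_congr rfl fun k _ => Finset.sum_congr rfl fun l _ => ?_
    rw [pderiv_pderiv_comm l j]
    ring
  have hbd : ∑ i, ∑ j, ∑ k, ∑ l, bivector c i j * bivector c k l *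
        (pderiv i (pderiv k a) * pderiv j b * pderiv l d) =
      ∑ i, ∑ j, ∑ k, ∑ l, bivector c i j * bivector c k l *
        (pderiv i (pderiv k a) * pderiv l b * pderiv j d) := by
    rw [sum_swap_pairs]
    refine Finset.sum_congr rfl fun i _ => Finset.sum_congr rfl fun j _ =>
      Finset.sum_congr rfl fun k _ => Finset.sum_congr rfl fun l _ => ?_
    rw [pderiv_pderiv_comm k i]
    ring
  have hda : ∑ i, ∑ j, ∑ k, ∑ l, bivector c i j * bivector c k l *
        (pderiv i d * pderiv j (pderiv k a) * pderiv l b) =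
      - ∑ i, ∑ j, ∑ k, ∑ l, bivector c i j * bivector c k l *
        (pderiv i (pderiv k a) * pderiv l b * pderiv j d) := by
    rw [Finset.sum_comm]
    simp only [← Finset.sum_neg_distrib]
    refine Finset.sum_congr rfl fun i _ => Finset.sum_congr rfl fun j _ =>
      Finset.sum_congr rfl fun k _ => Finset.sum_congr rfl fun l _ => ?_
    rw [bivector_skew hskew j i]
    ring
  have hdb : ∑ i, ∑ j, ∑ k, ∑ l, bivector c i j * bivector c k l *
        (pderiv i d * pderiv k a * pderiv j (pderiv l b)) =
      - ∑ i, ∑ j, ∑ k, ∑ l, bivector c i j * bivector c k l *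
        (pderiv i a * pderiv j (pderiv k b) * pderiv l d) := by
    rw [sum_swap_pairs]
    simp only [← Finset.sum_neg_distrib]
    refine Finset.sum_congr rfl fun i _ => Finset.sum_congr rfl fun j _ => ?_
    rw [Finset.sum_comm]
    refine Finset.sum_congr rfl fun k _ => Finset.sum_congr rfl fun l _ => ?_
    rw [bivector_skew hskew l k, pderiv_pderiv_comm k j]
    ring
  simp only [mul_add, mul_sub, add_mul, ← mul_assoc, Finset.sum_add_distrib,
    Finset.sum_sub_distrib] at hab hbd hda hdb ⊢
  rw [hda, hdb, hab, hbd]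
  set S₁ := ∑ i, ∑ j, ∑ k, ∑ l, bivector c i j * bivector c k l * pderiv i (pderiv k a) *
    pderiv l b * pderiv j d
  set S₂ := ∑ i, ∑ j, ∑ k, ∑ l, bivector c i j * bivector c k l * pderiv i a *
    pderiv k b * pderiv j (pderiv l d)
  linear_combination (S₁ - S₂) * half

lemma first_order_cancel {n : ℕ} {c : Fin n → Fin n → Fin n → ℂ}
    (hskew : ∀ k i j, c k i j = - c k j i)
    (hjac : ∀ i j l m, (∑ k, (c k i j * c m k l + c k j l * c m k i + c k l i * c m k j)) = 0)
    (a b d : MvPolynomial (Fin n) ℂ) :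
    (∑ x, ∑ y, ∑ z, nested c x y z * (pderiv x a * pderiv y b * pderiv z d))
      + (∑ x, ∑ y, ∑ z, nested c x y z * (pderiv x d * pderiv y a * pderiv z b))
      + C 3⁻¹ * (∑ i, ∑ j, ∑ k, nested c k j i *
        (pderiv i a * (pderiv k b * pderiv j d + pderiv j b * pderiv k d)
          - (pderiv k a * pderiv j b + pderiv j a * pderiv k b) * pderiv i d)) = 0 := by
  have third : (C 3⁻¹ : MvPolynomial (Fin n) ℂ) * 3 = 1 := by
    rw [show (3 : MvPolynomial (Fin n) ℂ) = C 3 from (map_ofNat C 3).symm, ← C_mul]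
    norm_num
  have hd : ∑ x, ∑ y, ∑ z, nested c x y z * (pderiv x d * pderiv y a * pderiv z b) =
      ∑ x, ∑ y, ∑ z, nested c z x y * (pderiv x a * pderiv y b * pderiv z d) := by
    rw [sum_rotate]
    refine Finset.sum_congr rfl fun x _ => Finset.sum_congr rfl fun y _ =>
      Finset.sum_congr rfl fun z _ => ?_
    ring
  have hkj : ∑ i, ∑ j, ∑ k, nested c k j i * (pderiv i a * pderiv k b * pderiv j d) =
      ∑ x, ∑ y, ∑ z, nested c y z x * (pderiv x a * pderiv y b * pderiv z d) :=
    Finset.sum_congr rfl fun x _ => Finset.sum_comm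
  have hzyx : ∑ i, ∑ j, ∑ k, nested c k j i * (pderiv k a * pderiv j b * pderiv i d) =
      ∑ x, ∑ y, ∑ z, nested c x y z * (pderiv x a * pderiv y b * pderiv z d) := by
    rw [sum_rotate]
    exact (Finset.sum_congr rfl fun _ _ => Finset.sum_comm).trans
      (sum_rotate fun x y z => nested c x y z * (pderiv x a * pderiv y b * pderiv z d)).symm
  have hyxz : ∑ i, ∑ j, ∑ k, nested c k j i * (pderiv j a * pderiv k b * pderiv i d) =
      ∑ x, ∑ y, ∑ z, nested c y x z * (pderiv x a * pderiv y b * pderiv z d) := by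
    rw [sum_rotate]
  simp only [mul_add, mul_sub, add_mul, ← mul_assoc, Finset.sum_add_distrib,
    Finset.sum_sub_distrib] at hd hkj hzyx hyxz ⊢
  rw [hd, hkj, hzyx, hyxz]
  simp only [← Finset.sum_add_distrib, ← Finset.sum_sub_distrib, Finset.mul_sum]
  refine Finset.sum_eq_zero fun x _ => Finset.sum_eq_zero fun y _ =>
    Finset.sum_eq_zero fun z _ => ?_
  have h := nested_jacobi hskew hjac y z x
  rw [nested_skew hskew z y x, nested_skew hskew y x z]
  linear_combination 2 * C 3⁻¹ * (pderiv x a * pderiv y b * pderiv z d) * h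
    - (pderiv x a * pderiv y b * pderiv z d) * (nested c x y z + nested c z x y) * third

/-- `{a,{b,c}} − {{a,b},c} + (d_H φ)(a,b,c) = 0`, i.e. the failure of the
Jacobi-type composition `P ∘ P` is the Hochschild coboundary of `φ`. -/
theorem stmt5 {n : ℕ} (c : Fin n → Fin n → Fin n → ℂ)
    (hskew : ∀ k i j, c k i j = - c k j i)
    (hjac : ∀ i j l m, (∑ k, (c k i j * c m k l + c k j l * c m k i + c k l i * c m k j)) = 0)
    (a b d : MvPolynomial (Fin n) ℂ) :
    Pb c a (Pb c b d) - Pb c (Pb c a b) d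
      + a * phiL c b d - phiL c (a * b) d + phiL c a (b * d) - phiL c a b * d = 0 := by
  have h := coboundary_phiL c a b d
  rw [Pb_skew hskew (Pb c a b) d, Pb_Pb_right, Pb_Pb_right]
  linear_combination h + second_order_cancel hskew a b d + first_order_cancel hskew hjac a b d

end
end

section
/- The noncommutative Poisson bracket is a Hochschild 2-coboundary on the classical family algebra: for all 𝒜, ℬ ∈ C_τ(𝔤), one has {𝒜,ℬ} = ∇(𝒜ℬ) − 𝒜·∇(ℬ) − ∇(𝒜)·ℬ; equivalently, P + d_H∇ = 0 in the Hochschild 2-cochains of C_τ(𝔤), so the class of P in HH²(C_τ(𝔤)) vanishes. -/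
open TensorProduct MvPolynomial

noncomputable section

/-- The noncommutative Poisson bracket on `End V ⊗ S(𝔤)`:
`{A ⊗ a, B ⊗ b} = AB ⊗ {a,b}`. -/
def Pnc {n : ℕ} (c : Fin n → Fin n → Fin n → ℂ) (V : Type*) [AddCommGroup V] [Module ℂ V] :
    (Module.End ℂ V ⊗[ℂ] MvPolynomial (Fin n) ℂ) →ₗ[ℂ]
      (Module.End ℂ V ⊗[ℂ] MvPolynomial (Fin n) ℂ) →ₗ[ℂ]
        (Module.End ℂ V ⊗[ℂ] MvPolynomial (Fin n) ℂ) :=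
  TensorProduct.map₂ (LinearMap.mul ℂ (Module.End ℂ V)) (Pb c)

/-- `A ↦ [f, A]` on `End V`. -/
def adE {V : Type*} [AddCommGroup V] [Module ℂ V] (f : Module.End ℂ V) :
    Module.End ℂ V →ₗ[ℂ] Module.End ℂ V :=
  LinearMap.mulLeft ℂ f - LinearMap.mulRight ℂ f

/-- The diagonal `𝔤`-action of the basis vector `X_l` on `End V ⊗ S(𝔤)`. -/
def Dact {n : ℕ} (c : Fin n → Fin n → Fin n → ℂ) {V : Type*} [AddCommGroup V] [Module ℂ V]
    (τ : Fin n → Module.End ℂ V) (l : Fin n) :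
    (Module.End ℂ V ⊗[ℂ] MvPolynomial (Fin n) ℂ) →ₗ[ℂ]
      (Module.End ℂ V ⊗[ℂ] MvPolynomial (Fin n) ℂ) :=
  LinearMap.rTensor _ (adE (τ l)) + LinearMap.lTensor _ (Pb c (X l))

/-- The map `∇ : A ⊗ a ↦ Σₖ A·τ(Xₖ) ⊗ ∂^k(a)` on `End V ⊗ S(𝔤)`. -/
def nabla {n : ℕ} {V : Type*} [AddCommGroup V] [Module ℂ V]
    (τ : Fin n → Module.End ℂ V) :
    (Module.End ℂ V ⊗[ℂ] MvPolynomial (Fin n) ℂ) →ₗ[ℂ]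
      (Module.End ℂ V ⊗[ℂ] MvPolynomial (Fin n) ℂ) :=
  ∑ k, (LinearMap.mulRight ℂ ((τ k) ⊗ₜ[ℂ] (1 : MvPolynomial (Fin n) ℂ))).comp
    (LinearMap.lTensor (Module.End ℂ V) (pderiv k).toLinearMap)

theorem Pb_eq_sum_pderiv_mul {n : ℕ} (c : Fin n → Fin n → Fin n → ℂ)
    (a b : MvPolynomial (Fin n) ℂ) :
    Pb c a b = ∑ k, pderiv k a * Pb c (X k) b := by
  classical
  have h (a : MvPolynomial (Fin n) ℂ) :
      Pb c a b = ∑ i, pderiv i a * ∑ j, ∑ k, c k i j • (X k * pderiv j b) := by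
    simp only [Pb, bil, LinearMap.sum_apply, LinearMap.smul_apply, LinearMap.compl₂_apply,
      LinearMap.comp_apply, LinearMap.mul_apply', LinearMap.mulLeft_apply,
      Derivation.coeFn_coe, Finset.mul_sum, mul_smul_comm]
    refine Finset.sum_congr rfl fun i _ => Finset.sum_congr rfl fun j _ =>
      Finset.sum_congr rfl fun k _ => ?_
    congr 1
    ring
  rw [h a]
  refine Finset.sum_congr rfl fun i _ => ?_
  rw [h (X i)]
  simp [pderiv_X, Pi.single_apply]

/-- On all of `End V ⊗ S(𝔤)`, the bracket `Pnc` is minus the Hochschild differential of `nabla` up to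
a term that vanishes when the second argument is invariant. -/
theorem Pnc_eq_nabla_add {n : ℕ} (c : Fin n → Fin n → Fin n → ℂ)
    {V : Type*} [AddCommGroup V] [Module ℂ V] (τ : Fin n → Module.End ℂ V)
    (𝒜 ℬ : Module.End ℂ V ⊗[ℂ] MvPolynomial (Fin n) ℂ) :
    Pnc c V 𝒜 ℬ = nabla τ (𝒜 * ℬ) - 𝒜 * nabla τ ℬ - nabla τ 𝒜 * ℬ +
      ∑ k, LinearMap.lTensor (Module.End ℂ V) (pderiv k).toLinearMap 𝒜 * Dact c τ k ℬ := by
  induction 𝒜 using TensorProduct.induction_on with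
  | zero => simp
  | add x y hx hy =>
    simp only [map_add, add_mul, LinearMap.add_apply, Finset.sum_add_distrib, hx, hy]
    abel
  | tmul A a =>
    induction ℬ using TensorProduct.induction_on with
    | zero => simp
    | add x y hx hy =>
      simp only [map_add, mul_add, Finset.sum_add_distrib, hx, hy]
      abel
    | tmul B b =>
      simp only [Pnc, TensorProduct.map₂_apply_tmul, TensorProduct.map_tmul, LinearMap.mul_apply',
        Pb_eq_sum_pderiv_mul c a b, TensorProduct.tmul_sum, nabla, Dact, adE,
        LinearMap.sum_apply, LinearMap.comp_apply, LinearMap.add_apply, LinearMap.sub_apply,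
        LinearMap.lTensor_tmul, LinearMap.rTensor_tmul, LinearMap.mulRight_apply,
        LinearMap.mulLeft_apply, Algebra.TensorProduct.tmul_mul_tmul,
        Derivation.coeFn_coe, Derivation.leibniz, smul_eq_mul,
        Finset.mul_sum, Finset.sum_mul, mul_one, ← Finset.sum_sub_distrib,
        ← Finset.sum_add_distrib]
      refine Finset.sum_congr rfl fun k _ => ?_
      simp only [mul_add, mul_sub, TensorProduct.tmul_add,
        TensorProduct.sub_tmul, Algebra.TensorProduct.tmul_mul_tmul, mul_assoc,
        mul_comm b (pderiv k a)]
      abel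

/-- on the classical family algebra, `{𝒜,ℬ} = ∇(𝒜ℬ) − 𝒜∇(ℬ) − ∇(𝒜)ℬ`,
i.e. `P + d_H ∇ = 0`: the noncommutative Poisson bracket is a Hochschild 2-coboundary
on `C_τ(𝔤)`, so its class in `HH²(C_τ(𝔤))` vanishes. -/
theorem stmt16 {n : ℕ} (c : Fin n → Fin n → Fin n → ℂ)
    {V : Type*} [AddCommGroup V] [Module ℂ V] (τ : Fin n → Module.End ℂ V)
    (hskew : ∀ k i j, c k i j = - c k j i)
    (hjac : ∀ i j l m, (∑ k, (c k i j * c m k l + c k j l * c m k i + c k l i * c m k j)) = 0)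
    (hτ : ∀ i j, τ i * τ j - τ j * τ i = ∑ k, c k i j • τ k)
    (𝒜 ℬ : Module.End ℂ V ⊗[ℂ] MvPolynomial (Fin n) ℂ)
    (h𝒜 : ∀ l, Dact c τ l 𝒜 = 0) (hℬ : ∀ l, Dact c τ l ℬ = 0) :
    Pnc c V 𝒜 ℬ = nabla τ (𝒜 * ℬ) - 𝒜 * nabla τ ℬ - nabla τ 𝒜 * ℬ := by
  rw [Pnc_eq_nabla_add c τ 𝒜 ℬ]
  simp [hℬ]

end
end
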